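/- arXiv:1805.09919 — 7 statements merged into one kernel-verified Lean document; each statement's English description precedes it below -/
import Mathlib

section
/- Let γ be a configuration conforming to the connector motif (n, m, d). Then the matching factors of all port types are equal: for all port types p and q, n p * d p * m q = n q * d q * m p. -/
/-- A configuration `γ` (a finset of connectors) conforms to the connector motif `(n, m, d)`
if it is nonempty, every connector `k ∈ γ` has exactly `m p` instances of each port type `p`,
and every instance `i : Fin (n p)` of each port type `p` belongs to exactly `d p`
connectors of `γ`. -/
def Conforms {P : Type*} [Fintype P] [DecidableEq P] (n m d : P → ℕ)
    (γ : Finset ((p : P) → Finset (Fin (n p)))) : Prop :=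
  γ.Nonempty ∧
    (∀ k ∈ γ, ∀ p : P, (k p).card = m p) ∧
    (∀ (p : P) (i : Fin (n p)), (γ.filter fun k => i ∈ k p).card = d p)

/-- Double counting of the incidences between instances of port type `p` and connectors. -/
theorem Conforms.card_mul_eq {P : Type*} [Fintype P] [DecidableEq P] {n m d : P → ℕ}
    {γ : Finset ((p : P) → Finset (Fin (n p)))} (hγ : Conforms n m d γ) (p : P) :
    n p * d p = γ.card * m p := by
  obtain ⟨-, hcard, hdeg⟩ := hγ
  have h := Finset.sum_card_bipartiteAbove_eq_sum_card_bipartiteBelow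
    (s := (Finset.univ : Finset (Fin (n p)))) (t := γ) (fun i k => i ∈ k p)
  simp only [Finset.bipartiteAbove, Finset.bipartiteBelow, hdeg, Finset.filter_univ_mem] at h
  rw [Finset.sum_congr rfl fun k hk => hcard k hk p] at h
  simpa using h

theorem stmt_1 {P : Type*} [Fintype P] [DecidableEq P] (n m d : P → ℕ)
    (hm : ∀ p, 0 < m p)
    (γ : Finset ((p : P) → Finset (Fin (n p)))) (hγ : Conforms n m d γ) :
    ∀ p q : P, n p * d p * m q = n q * d q * m p := by
  intro p q
  rw [hγ.card_mul_eq p, hγ.card_mul_eq q]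
  ring
end

section
/- (Lemma 1) Let γ be a configuration conforming to the connector motif (n, m, d), let k ∈ γ be a connector, let p be a port type, and let i, j : Fin (n p) be instances of p with i ∈ k p and j ∉ k p. Then there exists another connector k' ∈ γ with j ∈ k' p and i ∉ k' p. -/
theorem stmt_5 {P : Type*} [Fintype P] [DecidableEq P] (n m d : P → ℕ)
    (hm : ∀ p, 0 < m p)
    (γ : Finset ((p : P) → Finset (Fin (n p)))) (hγ : Conforms n m d γ)
    (k : (p : P) → Finset (Fin (n p))) (hk : k ∈ γ)
    (p : P) (i j : Fin (n p)) (hi : i ∈ k p) (hj : j ∉ k p) :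
    ∃ k' ∈ γ, k' ≠ k ∧ j ∈ k' p ∧ i ∉ k' p := by
  by_contra! h
  have hsub : (γ.filter fun k => j ∈ k p) ⊆ γ.filter fun k => i ∈ k p := by
    intro k' hk'
    obtain ⟨hk'γ, hjk'⟩ := Finset.mem_filter.1 hk'
    have hne : k' ≠ k := by
      rintro rfl
      exact hj hjk'
    exact Finset.mem_filter.2 ⟨hk'γ, h k' hk'γ hne hjk'⟩
  have heq := Finset.eq_of_subset_of_card_le hsub
    ((hγ.2.2 p i).trans (hγ.2.2 p j).symm).le
  have hki : k ∈ γ.filter fun k => i ∈ k p := Finset.mem_filter.2 ⟨hk, hi⟩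
  rw [← heq] at hki
  exact hj (Finset.mem_filter.1 hki).2
end

section
/- Suppose that for every port type p we have m p ≤ n p. Then in the full configuration Γ_full consisting of all connectors k with (k p).card = m p for every p, each fixed instance i : Fin (n p) of each port type p is contained (i.e., i ∈ k p) in exactly C(n p − 1, m p − 1) * ∏_{q ≠ p} C(n q, m q) connectors of Γ_full, where C denotes the binomial coefficient. -/
/-- The full configuration: all connectors `k` with `(k p).card = m p` for every `p`. -/
def FullConfig {P : Type*} [Fintype P] [DecidableEq P] (n m : P → ℕ) :
    Finset ((p : P) → Finset (Fin (n p))) :=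
  Finset.univ.filter fun k => ∀ p : P, (k p).card = m p

/-- The full configuration, restricted to connectors containing a given instance, is a product
of finsets. -/
theorem filter_fullConfig_eq_piFinset {P : Type*} [Fintype P] [DecidableEq P] (n m : P → ℕ)
    (p : P) (i : Fin (n p)) :
    ((FullConfig n m).filter fun k => i ∈ k p) =
      Fintype.piFinset (Function.update
        (fun q => (Finset.univ.powersetCard (m q) : Finset (Finset (Fin (n q))))) p
        ((Finset.powersetCard (m p) Finset.univ).filter ({i} ⊆ ·))) := by
  ext k
  simp only [FullConfig, Finset.mem_filter, Finset.mem_univ, true_and, Fintype.mem_piFinset]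
  rw [Function.forall_update_iff _ fun q s => k q ∈ s]
  simp only [Finset.mem_filter, Finset.mem_powersetCard_univ, Finset.singleton_subset_iff]
  constructor
  · rintro ⟨h, hi⟩
    exact ⟨⟨h p, hi⟩, fun q _ => h q⟩
  · rintro ⟨⟨hp, hi⟩, h⟩
    refine ⟨fun q => ?_, hi⟩
    obtain rfl | hq := eq_or_ne q p
    exacts [hp, h q hq]

theorem stmt_6 {P : Type*} [Fintype P] [DecidableEq P] (n m : P → ℕ)
    (hm : ∀ p, 0 < m p) (hmn : ∀ p, m p ≤ n p) :
    ∀ (p : P) (i : Fin (n p)),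
      ((FullConfig n m).filter fun k => i ∈ k p).card =
        (n p - 1).choose (m p - 1) * ∏ q ∈ Finset.univ.erase p, (n q).choose (m q) := by
  intro p i
  rw [filter_fullConfig_eq_piFinset, Fintype.card_piFinset,
    ← Finset.mul_prod_erase _ _ (Finset.mem_univ p), Function.update_self,
    Finset.card_filter_powersetCard_subset _ _ _ (Finset.subset_univ _)
      (by simpa using Nat.succ_le_of_lt (hm p))]
  congr 1
  · simp
  · refine Finset.prod_congr rfl fun q hq => ?_
    simp [Function.update_of_ne (Finset.ne_of_mem_erase hq)]
end

section
/- Suppose that for every port type p we have m p ≤ n p and n p * d p = m p * ∏_{q : P} C(n q, m q), where C denotes the binomial coefficient. Then the full configuration Γ_full, consisting of all connectors k with (k p).card = m p for every p, is a configuration conforming to the connector motif (n, m, d). -/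
theorem card_fullConfig {P : Type*} [Fintype P] [DecidableEq P] (n m : P → ℕ) :
    (FullConfig n m).card = ∏ q : P, (n q).choose (m q) := by
  have h : FullConfig n m =
      Fintype.piFinset fun q => Finset.powersetCard (m q) (Finset.univ : Finset (Fin (n q))) := by
    ext k
    simp [FullConfig, Fintype.mem_piFinset, Finset.mem_powersetCard]
  simp [h, Fintype.card_piFinset]

/-- An instance of a port type belongs to at most as many connectors of the full configuration
as any other instance of that type (hence to equally many, by symmetry). -/
theorem card_filter_mem_fullConfig_le {P : Type*} [Fintype P] [DecidableEq P] (n m : P → ℕ)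
    (p : P) (i j : Fin (n p)) :
    ((FullConfig n m).filter fun k => i ∈ k p).card ≤
      ((FullConfig n m).filter fun k => j ∈ k p).card := by
  let σ : (q : P) → Equiv.Perm (Fin (n q)) :=
    Function.update (fun q => Equiv.refl (Fin (n q))) p (Equiv.swap i j)
  refine Finset.card_le_card_of_injOn (fun k q => (k q).map (σ q).toEmbedding) ?_ ?_
  · intro k hk
    obtain ⟨hk, hi⟩ : (∀ q, (k q).card = m q) ∧ i ∈ k p := by simpa [FullConfig] using hk
    have hj : j ∈ (k p).map (σ p).toEmbedding :=
      Finset.mem_map.2 ⟨i, hi, by simp [σ]⟩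
    simpa only [FullConfig, Finset.coe_filter, Finset.mem_filter, Finset.mem_univ, true_and,
      Set.mem_ofPred_eq, Finset.card_map] using And.intro hk hj
  · intro k _ l _ h
    funext q
    exact Finset.map_injective _ (congrFun h q)

/-- Double counting of the incidences between connectors and instances of one port type. -/
theorem sum_card_filter_mem_fullConfig {P : Type*} [Fintype P] [DecidableEq P] (n m : P → ℕ)
    (p : P) :
    ∑ i : Fin (n p), ((FullConfig n m).filter fun k => i ∈ k p).card =
      m p * ∏ q : P, (n q).choose (m q) := by
  have h := Finset.sum_card_bipartiteAbove_eq_sum_card_bipartiteBelow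
    (s := (Finset.univ : Finset (Fin (n p)))) (t := FullConfig n m) fun i k => i ∈ k p
  simp only [Finset.bipartiteAbove, Finset.bipartiteBelow] at h
  rw [h, Finset.sum_const_nat (m := m p), card_fullConfig, mul_comm]
  intro k hk
  simpa using (Finset.mem_filter.1 hk).2 p

theorem stmt_7 {P : Type*} [Fintype P] [DecidableEq P] (n m d : P → ℕ)
    (hm : ∀ p, 0 < m p) (hmn : ∀ p, m p ≤ n p)
    (hd : ∀ p, n p * d p = m p * ∏ q : P, (n q).choose (m q)) :
    Conforms n m d (FullConfig n m) := by
  refine ⟨?_, fun k hk => (Finset.mem_filter.1 hk).2, fun p i => ?_⟩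
  · rw [← Finset.card_pos, card_fullConfig]
    exact Finset.prod_pos fun q _ => Nat.choose_pos (hmn q)
  · have h := sum_card_filter_mem_fullConfig n m p
    rw [Finset.sum_congr rfl fun j _ => (card_filter_mem_fullConfig_le n m p j i).antisymm
      (card_filter_mem_fullConfig_le n m p i j), ← hd p] at h
    simp only [Finset.sum_const, Finset.card_univ, Fintype.card_fin, smul_eq_mul] at h
    exact Nat.eq_of_mul_eq_mul_left ((hm p).trans_le (hmn p)) h
end

section
/- Suppose that for every port type p we have m p ≤ n p and n p * d p = m p * ∏_{q : P} C(n q, m q), where C denotes the binomial coefficient. Then every configuration γ conforming to the connector motif (n, m, d) equals the full configuration Γ_full consisting of all connectors k with (k p).card = m p for every p. -/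
/-- Every connector of a conforming configuration belongs to the full configuration. -/
theorem Conforms.subset_fullConfig {P : Type*} [Fintype P] [DecidableEq P] {n m d : P → ℕ}
    {γ : Finset ((p : P) → Finset (Fin (n p)))} (hγ : Conforms n m d γ) :
    γ ⊆ FullConfig n m := fun k hk =>
  Finset.mem_filter.2 ⟨Finset.mem_univ k, hγ.2.1 k hk⟩

/-- Double counting of the incidences between instances of type `p` and connectors. -/
theorem Conforms.mul_degree_eq {P : Type*} [Fintype P] [DecidableEq P] {n m d : P → ℕ}
    {γ : Finset ((p : P) → Finset (Fin (n p)))} (hγ : Conforms n m d γ) (p : P) :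
    n p * d p = m p * γ.card := by
  have h := Finset.sum_card_bipartiteAbove_eq_sum_card_bipartiteBelow
    (s := (Finset.univ : Finset (Fin (n p)))) (t := γ) (fun i k => i ∈ k p)
  have above : ∀ i ∈ (Finset.univ : Finset (Fin (n p))),
      (γ.bipartiteAbove (fun i k => i ∈ k p) i).card = d p := fun i _ => hγ.2.2 p i
  have below : ∀ k ∈ γ, (Finset.univ.bipartiteBelow
      (fun (i : Fin (n p)) (k : (p : P) → Finset (Fin (n p))) => i ∈ k p) k).card = m p := by
    intro k hk
    simpa [Finset.bipartiteBelow] using hγ.2.1 k hk p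
  rw [Finset.sum_const_nat above, Finset.sum_const_nat below] at h
  simpa [mul_comm] using h

theorem stmt_8 {P : Type*} [Fintype P] [DecidableEq P] (n m d : P → ℕ)
    (hm : ∀ p, 0 < m p) (hmn : ∀ p, m p ≤ n p)
    (hd : ∀ p, n p * d p = m p * ∏ q : P, (n q).choose (m q))
    (γ : Finset ((p : P) → Finset (Fin (n p)))) (hγ : Conforms n m d γ) :
    γ = FullConfig n m := by
  refine Finset.eq_of_subset_of_card_le hγ.subset_fullConfig ?_
  rw [card_fullConfig]
  rcases isEmpty_or_nonempty P with hP | ⟨⟨p⟩⟩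
  · simpa using hγ.1
  · exact (Nat.eq_of_mul_eq_mul_left (hm p) ((hd p).symm.trans (hγ.mul_degree_eq p))).le
end

section
/- (Proposition 1, sufficiency) Suppose that for every port type p we have m p ≤ n p and n p * d p = m p * ∏_{q : P} C(n q, m q), where C denotes the binomial coefficient. Then there exists exactly one configuration conforming to the connector motif (n, m, d). -/
/-- The finset of all connectors that have `m p` instances of each port type `p`. -/
def allConnectors {P : Type*} [Fintype P] [DecidableEq P] (n m : P → ℕ) :
    Finset ((p : P) → Finset (Fin (n p))) :=
  Fintype.piFinset fun p => Finset.powersetCard (m p) Finset.univ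

theorem mem_allConnectors {P : Type*} [Fintype P] [DecidableEq P] {n m : P → ℕ}
    {k : (p : P) → Finset (Fin (n p))} :
    k ∈ allConnectors n m ↔ ∀ p, (k p).card = m p := by
  simp [allConnectors, Finset.mem_powersetCard]

theorem card_allConnectors {P : Type*} [Fintype P] [DecidableEq P] (n m : P → ℕ) :
    (allConnectors n m).card = ∏ p, (n p).choose (m p) := by
  simp [allConnectors]

/-- Double counting of the incidences between connectors and instances of a port type. -/
theorem sum_card_filter_mem {P : Type*} {n m : P → ℕ}
    {γ : Finset ((p : P) → Finset (Fin (n p)))} {p : P}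
    (hγ : ∀ k ∈ γ, (k p).card = m p) :
    ∑ i : Fin (n p), (γ.filter fun k => i ∈ k p).card = m p * γ.card := by
  simp_rw [Finset.card_filter]
  rw [Finset.sum_comm, Finset.sum_congr rfl (g := fun _ => m p)]
  · simp [mul_comm]
  · intro k hk
    simp [hγ k hk]

theorem card_filter_mem_allConnectors_le {P : Type*} [Fintype P] [DecidableEq P]
    (n m : P → ℕ) (p : P) (i j : Fin (n p)) :
    ((allConnectors n m).filter fun k => i ∈ k p).card ≤
      ((allConnectors n m).filter fun k => j ∈ k p).card := by
  refine Finset.card_le_card_of_injOn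
    (fun k => Function.update k p ((k p).map (Equiv.swap i j).toEmbedding)) ?_ ?_
  · intro k hk
    simp only [Finset.coe_filter, Set.mem_ofPred_eq, mem_allConnectors] at hk ⊢
    refine ⟨fun q => ?_, ?_⟩
    · by_cases h : q = p
      · subst h
        simp [hk.1]
      · simp [h, hk.1]
    · rw [Function.update_self, Finset.mem_map]
      exact ⟨i, hk.2, by simp⟩
  · intro k _ l _ hkl
    funext q
    have hq := congrFun hkl q
    by_cases h : q = p
    · subst h
      simpa using hq
    · simpa [h] using hq

theorem card_filter_mem_allConnectors {P : Type*} [Fintype P] [DecidableEq P]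
    (n m : P → ℕ) (p : P) (i : Fin (n p)) :
    n p * ((allConnectors n m).filter fun k => i ∈ k p).card =
      m p * ∏ q, (n q).choose (m q) := by
  rw [← card_allConnectors,
    ← sum_card_filter_mem (p := p) fun k hk => mem_allConnectors.1 hk p,
    Finset.sum_congr rfl (fun j _ => le_antisymm
      (card_filter_mem_allConnectors_le n m p j i) (card_filter_mem_allConnectors_le n m p i j))]
  simp

theorem stmt_9 {P : Type*} [Fintype P] [DecidableEq P] (n m d : P → ℕ)
    (hm : ∀ p, 0 < m p) (hmn : ∀ p, m p ≤ n p)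
    (hd : ∀ p, n p * d p = m p * ∏ q : P, (n q).choose (m q)) :
    ∃! γ : Finset ((p : P) → Finset (Fin (n p))), Conforms n m d γ := by
  have hne : (allConnectors n m).Nonempty := by
    rw [← Finset.card_pos, card_allConnectors]
    exact Finset.prod_pos fun p _ => Nat.choose_pos (hmn p)
  refine ⟨allConnectors n m, ⟨hne, fun k hk => mem_allConnectors.1 hk, fun p i => ?_⟩, ?_⟩
  · refine Nat.eq_of_mul_eq_mul_left ((hm p).trans_le (hmn p)) ?_
    rw [card_filter_mem_allConnectors, hd]
  · rintro γ ⟨hγ, hcard, hdeg⟩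
    refine Finset.eq_of_subset_of_card_le (fun k hk => mem_allConnectors.2 (hcard k hk)) ?_
    rcases isEmpty_or_nonempty P with hP | ⟨⟨p⟩⟩
    · rw [card_allConnectors, Finset.univ_eq_empty, Finset.prod_empty]
      exact hγ.card_pos
    · refine (Nat.eq_of_mul_eq_mul_left (hm p) ?_).le
      rw [card_allConnectors, ← hd, ← sum_card_filter_mem fun k hk => hcard k hk p]
      simp [hdeg]
end

section
/- If γ is a configuration conforming to the connector motif (n, m, d) and γ.card < ∏_{q : P} C(n q, m q), where C denotes the binomial coefficient, then there exists another configuration γ' ≠ γ that also conforms to the connector motif (n, m, d); i.e., the motif has multiple conforming configurations. -/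
/-- Two finsets of the same cardinality in a finite type are related by a permutation. -/
theorem exists_perm_map_eq {α : Type*} [Fintype α] [DecidableEq α] {s t : Finset α}
    (h : s.card = t.card) : ∃ σ : Equiv.Perm α, s.map σ.toEmbedding = t := by
  refine ⟨(Finset.equivOfCardEq h).extendSubtype, ?_⟩
  apply Finset.eq_of_subset_of_card_le
  · intro x hx
    obtain ⟨y, hy, rfl⟩ := Finset.mem_map.1 hx
    exact (Finset.equivOfCardEq h).extendSubtype_mem y hy
  · rw [Finset.card_map, h]

/-- Conforming configurations are preserved by permuting the instances of each port type. -/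
theorem Conforms.image_perm {P : Type*} [Fintype P] [DecidableEq P] {n m d : P → ℕ}
    {γ : Finset ((p : P) → Finset (Fin (n p)))} (hγ : Conforms n m d γ)
    (σ : (p : P) → Equiv.Perm (Fin (n p))) :
    Conforms n m d (γ.image fun k p => (k p).map (σ p).toEmbedding) := by
  obtain ⟨hne, hcard, hdeg⟩ := hγ
  refine ⟨hne.image _, ?_, ?_⟩
  · intro k hk p
    obtain ⟨l, hl, rfl⟩ := Finset.mem_image.1 hk
    simpa using hcard l hl p
  · intro p i
    have hinj : Function.Injective
        fun (k : (p : P) → Finset (Fin (n p))) p => (k p).map (σ p).toEmbedding :=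
      fun k l hkl => funext fun q => Finset.map_injective _ (congrFun hkl q)
    rw [Finset.filter_image, Finset.card_image_of_injective _ hinj, ← hdeg p ((σ p).symm i)]
    simp only [Finset.mem_map_equiv]

theorem stmt_10 {P : Type*} [Fintype P] [DecidableEq P] (n m d : P → ℕ)
    (hm : ∀ p, 0 < m p)
    (γ : Finset ((p : P) → Finset (Fin (n p)))) (hγ : Conforms n m d γ)
    (hlt : γ.card < ∏ q : P, (n q).choose (m q)) :
    ∃ γ' : Finset ((p : P) → Finset (Fin (n p))), γ' ≠ γ ∧ Conforms n m d γ' := by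
  by_contra! hunique
  obtain ⟨k₀, hk₀⟩ := hγ.1
  have hsub : Fintype.piFinset
      (fun p => Finset.powersetCard (m p) (Finset.univ : Finset (Fin (n p))))
      ⊆ γ := by
    intro k hk
    have hk : ∀ p, (k p).card = m p := by simpa [Fintype.mem_piFinset] using hk
    choose σ hσ using fun p => exists_perm_map_eq ((hγ.2.1 k₀ hk₀ p).trans (hk p).symm)
    have himage : (γ.image fun k p => (k p).map (σ p).toEmbedding) = γ := by
      by_contra hne
      exact hunique _ hne (hγ.image_perm σ)
    rw [← himage]
    exact Finset.mem_image.2 ⟨k₀, hk₀, funext hσ⟩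
  have hle := Finset.card_le_card hsub
  simp only [Fintype.card_piFinset, Finset.card_powersetCard, Finset.card_univ,
    Fintype.card_fin] at hle
  exact hlt.not_ge hle
end
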